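/- arXiv:2410.06368 — 8 statements merged into one kernel-verified Lean document; each statement's English description precedes it below -/
import Mathlib

section
/- (Donoho–Stark uncertainty principle) Let G be a finite abelian group and f : G → ℂ a nonzero function. Then |Supp f| · |Supp f̂| ≥ |G|. -/
/-- The Fourier transform of `f : G → ℂ`, as a function on the dual group `Ĝ = AddChar G ℂ`
(the group of functions `h : G → ℂ∖{0}` with `h (x+y) = h x * h y`):
`f̂(h) = |G|^{-1/2} ∑ₓ f(x) · conj (h x)`. -/
noncomputable def fourierT {G : Type*} [AddCommGroup G] [Fintype G] (f : G → ℂ) :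
    AddChar G ℂ → ℂ :=
  fun χ => (Real.sqrt (Fintype.card G) : ℂ)⁻¹ * ∑ x, f x * (starRingEnd ℂ) (χ x)

open Finset in
/-- Fourier inversion for `fourierT`. -/
theorem sum_fourierT_mul_apply {G : Type*} [AddCommGroup G] [Fintype G] (f : G → ℂ) (x : G) :
    ∑ χ : AddChar G ℂ, fourierT f χ * χ x = (Real.sqrt (Fintype.card G) : ℂ) * f x := by
  classical
  have hN : (Real.sqrt (Fintype.card G) : ℂ) ≠ 0 := by
    exact_mod_cast (Real.sqrt_pos.2 (Nat.cast_pos.2 Fintype.card_pos)).ne'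
  have hsq : (Real.sqrt (Fintype.card G) : ℂ) * Real.sqrt (Fintype.card G) = Fintype.card G := by
    exact_mod_cast Real.mul_self_sqrt (Nat.cast_nonneg (Fintype.card G))
  calc ∑ χ : AddChar G ℂ, fourierT f χ * χ x
      = (Real.sqrt (Fintype.card G) : ℂ)⁻¹ * ∑ y, f y * ∑ χ : AddChar G ℂ, χ (x - y) := by
        simp only [fourierT, mul_sum, sum_mul]
        rw [sum_comm]
        refine sum_congr rfl fun y _ => sum_congr rfl fun χ _ => ?_
        rw [sub_eq_add_neg, AddChar.map_add_eq_mul, AddChar.map_neg_eq_conj]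
        ring
    _ = (Real.sqrt (Fintype.card G) : ℂ)⁻¹ * (f x * Fintype.card G) := by
        simp [AddChar.sum_apply_eq_ite, sub_eq_zero]
    _ = _ := by
        rw [← hsq]
        field_simp

theorem norm_fourierT_le {G : Type*} [AddCommGroup G] [Fintype G] (f : G → ℂ) {M : ℝ}
    (hM : ∀ x, ‖f x‖ ≤ M) (χ : AddChar G ℂ) :
    ‖fourierT f χ‖ ≤ (Real.sqrt (Fintype.card G))⁻¹ * ((Function.support f).ncard * M) := by
  classical
  rw [fourierT, norm_mul, norm_inv, Complex.norm_real, Real.norm_of_nonneg (Real.sqrt_nonneg _),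
    Set.ncard_eq_toFinset_card']
  gcongr
  rw [← Finset.sum_subset (Finset.subset_univ (Function.support f).toFinset)
    (fun x _ hx => by simp_all), ← nsmul_eq_mul]
  refine (norm_sum_le _ _).trans (Finset.sum_le_card_nsmul _ _ _ fun x _ => ?_)
  simpa using hM x

/-- Donoho–Stark uncertainty principle.  For a nonzero `f : G → ℂ` on a
finite abelian group `G`, `|Supp f| ⬝ |Supp f̂| ≥ |G|`. -/
theorem stmt_5 {G : Type*} [AddCommGroup G] [Fintype G] (f : G → ℂ) (hf : f ≠ 0) :
    Fintype.card G ≤ (Function.support f).ncard * (Function.support (fourierT f)).ncard := by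
  classical
  obtain ⟨x, -, hx⟩ := Finset.exists_max_image Finset.univ (fun x => ‖f x‖) Finset.univ_nonempty
  have hM (y : G) : ‖f y‖ ≤ ‖f x‖ := hx y (Finset.mem_univ y)
  have hpos : 0 < ‖f x‖ := by
    obtain ⟨y, hy⟩ := Function.ne_iff.1 hf
    exact (norm_pos_iff.2 hy).trans_le (hM y)
  have hN : 0 < Real.sqrt (Fintype.card G) := Real.sqrt_pos.2 (Nat.cast_pos.2 Fintype.card_pos)
  have key : Real.sqrt (Fintype.card G) * ‖f x‖ ≤ (Function.support (fourierT f)).ncard *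
      ((Real.sqrt (Fintype.card G))⁻¹ * ((Function.support f).ncard * ‖f x‖)) := by
    have h := congrArg norm (sum_fourierT_mul_apply f x)
    rw [norm_mul, Complex.norm_real, Real.norm_of_nonneg hN.le] at h
    rw [← h, Set.ncard_eq_toFinset_card',
      ← Finset.sum_subset (Finset.subset_univ (Function.support (fourierT f)).toFinset)
        (fun χ _ hχ => by simp_all), ← nsmul_eq_mul]
    refine (norm_sum_le _ _).trans (Finset.sum_le_card_nsmul _ _ _ fun χ _ => ?_)
    simpa using norm_fourierT_le f hM χ
  have hcard : (Fintype.card G : ℝ) * ‖f x‖ ≤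
      ((Function.support f).ncard * (Function.support (fourierT f)).ncard) * ‖f x‖ := by
    calc (Fintype.card G : ℝ) * ‖f x‖
        = Real.sqrt (Fintype.card G) * (Real.sqrt (Fintype.card G) * ‖f x‖) := by
          rw [← mul_assoc, Real.mul_self_sqrt (Nat.cast_nonneg _)]
      _ ≤ _ := mul_le_mul_of_nonneg_left key hN.le
      _ = _ := by field_simp
  exact_mod_cast le_of_mul_le_mul_right hcard hpos
end

section
/- For every positive integer d, the classical value of the d-fold parallel repeated 4-player GHZ game is at most the classical value of the d-fold parallel repeated 3-player GHZ game: ω^c(GHZ_4^d) ≤ ω^c(GHZ_3^d). -/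
open Classical in
/-- The classical value `ω^c(GHZ_k^d)` of the `d`-fold parallel repetition of the `k`-player
GHZ game: the maximum, over deterministic strategies `A i : {0,1}^d → {0,1}^d`, of the
probability (over inputs `x : Fin k → Fin d → Bool`, uniform subject to every coordinate
`j` having even parity) that in every coordinate `j` one has
`∑ᵢ xᵢⱼ + 2 ∑ᵢ aᵢⱼ ≡ 0 (mod 4)`, where `a i = A i (x i)`. -/
noncomputable def ghzValue (k d : ℕ) : ℝ :=
  ⨆ A : Fin k → (Fin d → Bool) → (Fin d → Bool),
    (((Finset.univ.filter (fun x : Fin k → Fin d → Bool =>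
        (∀ j, (∑ i, (if x i j then (1 : ZMod 2) else 0)) = 0) ∧
        (∀ j, (∑ i, (if x i j then (1 : ZMod 4) else 0)) +
            2 * (∑ i, (if A i (x i) j then (1 : ZMod 4) else 0)) = 0))).card : ℝ) /
      ((Finset.univ.filter (fun x : Fin k → Fin d → Bool =>
        ∀ j, (∑ i, (if x i j then (1 : ZMod 2) else 0)) = 0)).card : ℝ))

/-- Inputs of the `(k+1)`-player game correspond to an input `y` of the first player together with
inputs of the other `k` players, here shifted by `y`. -/
def consXorEquiv (k d : ℕ) :
    (Fin d → Bool) × (Fin k → Fin d → Bool) ≃ (Fin (k + 1) → Fin d → Bool) where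
  toFun p := Fin.cons p.1 (fun i j => xor (p.2 i j) (p.1 j))
  invFun x := (x 0, fun i j => xor (x i.succ j) (x 0 j))
  left_inv p := by ext <;> simp
  right_inv x := by
    funext i
    refine Fin.cases ?_ (fun i => ?_) i <;> simp

/-- The three-player strategy obtained from a four-player one by fixing the first input to `y`,
flipping the remaining inputs where `y` is set, and letting one player add the first answer. -/
def fixFirst {d : ℕ} (A : Fin 4 → (Fin d → Bool) → (Fin d → Bool)) (y : Fin d → Bool) :
    Fin 3 → (Fin d → Bool) → (Fin d → Bool) :=
  fun i u j => xor (A i.succ (fun l => xor (u l) (y l)) j) (if i = 0 then A 0 y j else false)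

lemma parity_cons_xor (y x₀ x₁ x₂ : Bool) :
    ((if y then (1 : ZMod 2) else 0) + ((if xor x₀ y then (1 : ZMod 2) else 0) +
      ((if xor x₁ y then (1 : ZMod 2) else 0) + (if xor x₂ y then (1 : ZMod 2) else 0))) = 0) ↔
    ((if x₀ then (1 : ZMod 2) else 0) + ((if x₁ then (1 : ZMod 2) else 0) +
      (if x₂ then (1 : ZMod 2) else 0)) = 0) := by
  revert y x₀ x₁ x₂; decide

lemma win_cons_xor (y x₀ x₁ x₂ b a₀ a₁ a₂ : Bool)
    (h : (if x₀ then (1 : ZMod 2) else 0) + ((if x₁ then (1 : ZMod 2) else 0) +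
      (if x₂ then (1 : ZMod 2) else 0)) = 0) :
    ((if y then (1 : ZMod 4) else 0) + ((if xor x₀ y then (1 : ZMod 4) else 0) +
      ((if xor x₁ y then (1 : ZMod 4) else 0) + (if xor x₂ y then (1 : ZMod 4) else 0))) +
      2 * ((if b then (1 : ZMod 4) else 0) + ((if a₀ then (1 : ZMod 4) else 0) +
      ((if a₁ then (1 : ZMod 4) else 0) + (if a₂ then (1 : ZMod 4) else 0)))) = 0) ↔
    ((if x₀ then (1 : ZMod 4) else 0) + ((if x₁ then (1 : ZMod 4) else 0) +
      (if x₂ then (1 : ZMod 4) else 0)) +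
      2 * ((if xor a₀ b then (1 : ZMod 4) else 0) + ((if xor a₁ false then (1 : ZMod 4) else 0) +
      (if xor a₂ false then (1 : ZMod 4) else 0))) = 0) := by
  revert y x₀ x₁ x₂ b a₀ a₁ a₂; decide

/-- Every coordinate of the input has even parity. -/
def EvenInput {k d : ℕ} (x : Fin k → Fin d → Bool) : Prop :=
  ∀ j, (∑ i, (if x i j then (1 : ZMod 2) else 0)) = 0

/-- The strategy `A` wins every coordinate on the input `x`. -/
def Wins {k d : ℕ} (A : Fin k → (Fin d → Bool) → (Fin d → Bool))
    (x : Fin k → Fin d → Bool) : Prop :=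
  ∀ j, (∑ i, (if x i j then (1 : ZMod 4) else 0)) +
    2 * (∑ i, (if A i (x i) j then (1 : ZMod 4) else 0)) = 0

lemma evenInput_consXorEquiv {d : ℕ} (p : (Fin d → Bool) × (Fin 3 → Fin d → Bool)) :
    EvenInput (consXorEquiv 3 d p) ↔ EvenInput p.2 := by
  refine forall_congr' fun j => ?_
  have := parity_cons_xor (p.1 j) (p.2 0 j) (p.2 1 j) (p.2 2 j)
  simp only [Fin.sum_univ_succ, Fin.sum_univ_zero, add_zero]
  exact this

lemma wins_consXorEquiv {d : ℕ} (A : Fin 4 → (Fin d → Bool) → (Fin d → Bool))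
    (p : (Fin d → Bool) × (Fin 3 → Fin d → Bool)) (h : EvenInput p.2) :
    Wins A (consXorEquiv 3 d p) ↔ Wins (fixFirst A p.1) p.2 := by
  refine forall_congr' fun j => ?_
  have hj := h j
  simp only [Fin.sum_univ_succ, Fin.sum_univ_zero, add_zero] at hj ⊢
  exact win_cons_xor (p.1 j) (p.2 0 j) (p.2 1 j) (p.2 2 j) (A 0 p.1 j)
    (A 1 (fun l => xor (p.2 0 l) (p.1 l)) j) (A 2 (fun l => xor (p.2 1 l) (p.1 l)) j)
    (A 3 (fun l => xor (p.2 2 l) (p.1 l)) j) hj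

lemma card_filter_consXorEquiv {k d : ℕ} (P : (Fin (k + 1) → Fin d → Bool) → Prop)
    (Q : (Fin d → Bool) → (Fin k → Fin d → Bool) → Prop)
    [DecidablePred P] [∀ y, DecidablePred (Q y)] (h : ∀ p, P (consXorEquiv k d p) ↔ Q p.1 p.2) :
    (Finset.univ.filter P).card = ∑ y, (Finset.univ.filter (Q y)).card := by
  simp only [Finset.card_filter]
  rw [← (consXorEquiv k d).sum_comp, Fintype.sum_prod_type]
  simp only [h]

open Classical in
lemma ghzValue_eq (k d : ℕ) :
    ghzValue k d = ⨆ A : Fin k → (Fin d → Bool) → (Fin d → Bool),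
      ((Finset.univ.filter fun x => EvenInput x ∧ Wins A x).card : ℝ) /
        ((Finset.univ.filter fun x : Fin k → Fin d → Bool => EvenInput x).card : ℝ) := by
  unfold ghzValue EvenInput Wins
  congr!

open Classical in
lemma card_wins_le {k d : ℕ} (A : Fin k → (Fin d → Bool) → (Fin d → Bool)) :
    ((Finset.univ.filter fun x => EvenInput x ∧ Wins A x).card : ℝ) ≤
      ghzValue k d *
        ((Finset.univ.filter fun x : Fin k → Fin d → Bool => EvenInput x).card : ℝ) := by
  have hpos : (0 : ℝ) <
      (Finset.univ.filter fun x : Fin k → Fin d → Bool => EvenInput x).card := by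
    exact_mod_cast Finset.card_pos.2 ⟨fun _ _ => false, by simp [EvenInput]⟩
  rw [← div_le_iff₀ hpos, ghzValue_eq]
  exact le_ciSup (f := fun A : Fin k → (Fin d → Bool) → (Fin d → Bool) =>
    ((Finset.univ.filter fun x => EvenInput x ∧ Wins A x).card : ℝ) /
      ((Finset.univ.filter fun x : Fin k → Fin d → Bool => EvenInput x).card : ℝ))
    (Set.finite_range _).bddAbove A

/-- For every positive integer `d`, `ω^c(GHZ_4^d) ≤ ω^c(GHZ_3^d)`. -/
theorem stmt_6 (d : ℕ) (hd : 0 < d) : ghzValue 4 d ≤ ghzValue 3 d := by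
  classical
  rw [ghzValue_eq 4 d]
  refine ciSup_le fun A => ?_
  have hpos : (0 : ℝ) <
      (Finset.univ.filter fun x : Fin 4 → Fin d → Bool => EvenInput x).card := by
    exact_mod_cast Finset.card_pos.2 ⟨fun _ _ => false, by simp [EvenInput]⟩
  rw [div_le_iff₀ hpos,
    card_filter_consXorEquiv (fun x => EvenInput x ∧ Wins A x)
      (fun y x => EvenInput x ∧ Wins (fixFirst A y) x) fun p => by
      rw [evenInput_consXorEquiv]
      exact and_congr_right (wins_consXorEquiv A p),
    card_filter_consXorEquiv EvenInput (fun _ x => EvenInput x) evenInput_consXorEquiv]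
  push_cast
  rw [Finset.mul_sum]
  exact Finset.sum_le_sum fun y _ => card_wins_le (fixFirst A y)
end

section
/- The classical value of the 4-player GHZ game equals 3/4: ω^c(GHZ_4) = 3/4. -/
open Classical in
/-- The classical value `ω^c(GHZ_4)` of the 4-player GHZ game: the maximum over
deterministic strategies `A i : {0,1} → {0,1}` of the probability (over inputs
`x : Fin 4 → Bool`, uniform subject to `x₁ ⊕ x₂ ⊕ x₃ ⊕ x₄ = 0`) that
`x₁ + x₂ + x₃ + x₄ + 2a₁ + 2a₂ + 2a₃ + 2a₄ ≡ 0 (mod 4)` where `aᵢ = A i xᵢ`. -/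
noncomputable def ghz4Value : ℝ :=
  ⨆ A : Fin 4 → Bool → Bool,
    (((Finset.univ.filter (fun x : Fin 4 → Bool =>
        (∑ i, (if x i then (1 : ZMod 2) else 0)) = 0 ∧
        (∑ i, (if x i then (1 : ZMod 4) else 0)) +
          2 * (∑ i, (if A i (x i) then (1 : ZMod 4) else 0)) = 0)).card : ℝ) /
      ((Finset.univ.filter (fun x : Fin 4 → Bool =>
        (∑ i, (if x i then (1 : ZMod 2) else 0)) = 0)).card : ℝ))

/-- The number of inputs on which the deterministic strategy `A` wins. -/
def ghz4Wins (A : Fin 4 → Bool → Bool) : ℕ :=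
  (Finset.univ.filter (fun x : Fin 4 → Bool =>
    (∑ i, (if x i then (1 : ZMod 2) else 0)) = 0 ∧
    (∑ i, (if x i then (1 : ZMod 4) else 0)) +
      2 * (∑ i, (if A i (x i) then (1 : ZMod 4) else 0)) = 0)).card

theorem card_ghz4Inputs :
    (Finset.univ.filter (fun x : Fin 4 → Bool =>
      (∑ i, (if x i then (1 : ZMod 2) else 0)) = 0)).card = 8 := by
  decide +kernel

theorem ghz4Wins_le (A : Fin 4 → Bool → Bool) : ghz4Wins A ≤ 6 := by
  revert A
  decide +kernel

/-- The strategy in which only the first player answers `1` wins on all inputs of weight two. -/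
theorem ghz4Wins_first : ghz4Wins (fun i _ => decide (i = 0)) = 6 := by
  decide +kernel

theorem ghz4Value_eq_iSup : ghz4Value = ⨆ A, (ghz4Wins A : ℝ) / 8 := by
  rw [show (8 : ℝ) = (8 : ℕ) by norm_num, ← card_ghz4Inputs]
  unfold ghz4Value ghz4Wins
  congr!

/-- The classical value of the 4-player GHZ game is `3/4`. -/
theorem stmt_7 : ghz4Value = 3 / 4 := by
  rw [ghz4Value_eq_iSup]
  refine le_antisymm (ciSup_le fun A => ?_) ?_
  · have h : (ghz4Wins A : ℝ) ≤ 6 := by exact_mod_cast ghz4Wins_le A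
    linarith
  · refine le_ciSup_of_le (Set.finite_range _).bddAbove (fun i _ => decide (i = 0)) ?_
    rw [ghz4Wins_first]
    norm_num
end

section
/- Let T be a parity-balanced subset of (ℤ/4)^d. Then η(T) ≤ ω^c(GHZ_4^d), where η(T) is the linearity coefficient of T and ω^c(GHZ_4^d) is the classical value of the d-fold parallel repeated 4-player GHZ game. Concretely, since the uniform distribution on T has collision probability 2^{-d}, this says 2^d · P[t₁+t₂ = t₃+t₄ | t₁,t₂,t₃,t₄ ← T uniform and independent] ≤ ω^c(GHZ_4^d). -/
/-- The linearity coefficient `η(S)` of a finite subset `S` of an abelian group: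
`P[x+y = z+w ∣ x,y,z,w ← S uniform] / P[x = y ∣ x,y ← S uniform]`. -/
noncomputable def linCoeffSet {α : Type*} [AddCommGroup α] [DecidableEq α] (S : Finset α) : ℝ :=
  ((((S ×ˢ S ×ˢ S ×ˢ S).filter
      (fun q => q.1 + q.2.1 = q.2.2.1 + q.2.2.2)).card : ℝ) / (S.card : ℝ) ^ 4) /
    ((((S ×ˢ S).filter (fun q => q.1 = q.2)).card : ℝ) / (S.card : ℝ) ^ 2)

/-- The coordinatewise parity of a vector over `ℤ/4`, as a bit vector. -/
def lowBits {d : ℕ} (v : Fin d → ZMod 4) : Fin d → Bool := fun j => decide (v j = 1 ∨ v j = 3)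

/-- The coordinatewise high binary digit of a vector over `ℤ/4`, as a bit vector. -/
def highBits {d : ℕ} (v : Fin d → ZMod 4) : Fin d → Bool := fun j => decide (v j = 2 ∨ v j = 3)

theorem lowBits_neg {d : ℕ} (v : Fin d → ZMod 4) : lowBits (-v) = lowBits v := by
  have key : ∀ t : ZMod 4, (-t = 1 ∨ -t = 3) ↔ (t = 1 ∨ t = 3) := by decide
  funext j
  simp only [lowBits, Pi.neg_apply, key]

theorem lowBits_add_two_mul_highBits {d : ℕ} (v : Fin d → ZMod 4) (j : Fin d) :
    (if lowBits v j then (1 : ZMod 4) else 0) + 2 * (if highBits v j then 1 else 0) = v j := by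
  have key : ∀ t : ZMod 4, (if decide (t = 1 ∨ t = 3) then (1 : ZMod 4) else 0) +
      2 * (if decide (t = 2 ∨ t = 3) then 1 else 0) = t := by decide
  exact key (v j)

theorem lowBits_eq_castHom {d : ℕ} (v : Fin d → ZMod 4) (j : Fin d) :
    (if lowBits v j then (1 : ZMod 2) else 0) =
      ZMod.castHom (by norm_num : (2 : ℕ) ∣ 4) (ZMod 2) (v j) := by
  have key : ∀ t : ZMod 4, (if decide (t = 1 ∨ t = 3) then (1 : ZMod 2) else 0) =
      ZMod.castHom (by norm_num : (2 : ℕ) ∣ 4) (ZMod 2) t := by decide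
  exact key (v j)

theorem lowBits_injOn {d : ℕ} {T : Set (Fin d → ZMod 4)}
    (hT : Set.InjOn (fun v : Fin d → ZMod 4 => fun j =>
      ZMod.castHom (by norm_num : (2 : ℕ) ∣ 4) (ZMod 2) (v j)) T) :
    Set.InjOn lowBits T := by
  intro u hu v hv huv
  refine hT hu hv ?_
  funext j
  simp only [← lowBits_eq_castHom, huv]

/-- The winning probability of any strategy is at most the value of the game. -/
theorem le_ghzValue_of_card {k d : ℕ} (A : Fin k → (Fin d → Bool) → (Fin d → Bool))
    (W E : Finset (Fin k → Fin d → Bool))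
    (hE : ∀ x, (∀ j, (∑ i, (if x i j then (1 : ZMod 2) else 0)) = 0) ↔ x ∈ E)
    (hW : ∀ x ∈ W, x ∈ E ∧ ∀ j, (∑ i, (if x i j then (1 : ZMod 4) else 0)) +
      2 * (∑ i, (if A i (x i) j then (1 : ZMod 4) else 0)) = 0) :
    (W.card : ℝ) / E.card ≤ ghzValue k d := by
  classical
  refine le_ciSup_of_le (Set.finite_range _).bddAbove A ?_
  have hE' : (Finset.univ.filter fun x : Fin k → Fin d → Bool =>
      ∀ j, (∑ i, (if x i j then (1 : ZMod 2) else 0)) = 0) = E := by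
    ext x
    simp [← hE]
  rw [← hE'] at hW ⊢
  refine div_le_div₀ (Nat.cast_nonneg _) (Nat.cast_le.2 (Finset.card_le_card ?_)) ?_ (le_of_eq ?_)
  · intro x hx
    obtain ⟨h₁, h₂⟩ := hW x hx
    exact Finset.mem_filter.2 ⟨Finset.mem_univ _, (Finset.mem_filter.1 h₁).2, h₂⟩
  · refine Nat.cast_pos.2 (Finset.card_pos.2 ⟨fun _ _ => false, ?_⟩)
    exact Finset.mem_filter.2 ⟨Finset.mem_univ _, fun j =>
      Finset.sum_eq_zero fun _ _ => if_neg Bool.false_ne_true⟩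
  · congr!

/-- A four-player input of even parity is determined by the inputs of three players. -/
theorem card_evenParity_le (d : ℕ) (E : Finset (Fin 4 → Fin d → Bool))
    (hE : ∀ x, (∀ j, (∑ i, (if x i j then (1 : ZMod 2) else 0)) = 0) ↔ x ∈ E) :
    E.card ≤ (2 ^ d) ^ 3 := by
  have hinj : Set.InjOn (fun x : Fin 4 → Fin d → Bool => fun i : Fin 3 => x i.castSucc) E := by
    intro x hx y hy hxy
    have h : ∀ i : Fin 3, x i.castSucc = y i.castSucc := fun i => congrFun hxy i
    have hlast : x (Fin.last 3) = y (Fin.last 3) := by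
      funext j
      have hx' := (hE x).2 hx j
      have hy' := (hE y).2 hy j
      rw [Fin.sum_univ_castSucc] at hx' hy'
      simp only [h] at hx'
      have heq := add_left_cancel (hx'.trans hy'.symm)
      revert heq
      cases x (Fin.last 3) j <;> cases y (Fin.last 3) j <;> decide
    funext i
    exact Fin.lastCases (motive := fun i => x i = y i) hlast h i
  have := Finset.card_le_card_of_injOn (t := Finset.univ) _ (fun _ _ => Finset.mem_univ _) hinj
  simpa using this

theorem linCoeffSet_eq {α : Type*} [AddCommGroup α] [DecidableEq α] (S : Finset α) :
    linCoeffSet S = S.card * ((((S ×ˢ S ×ˢ S ×ˢ S).filter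
      (fun q => q.1 + q.2.1 = q.2.2.1 + q.2.2.2)).card : ℝ) / (S.card : ℝ) ^ 4) := by
  have hdiag : ((S ×ˢ S).filter (fun q => q.1 = q.2)).card = S.card := by
    rw [← Finset.diag_eq_filter, Finset.diag_card]
  rw [linCoeffSet, hdiag]
  rcases eq_or_ne (S.card : ℝ) 0 with h | h
  · simp [h]
  · field_simp

/-- If `T` is a parity-balanced subset of `(ℤ/4)^d` (the mod-2 reduction map
restricts to a bijection from `T` onto `(ℤ/2)^d`), then `η(T) ≤ ω^c(GHZ_4^d)`; concretely,
`2^d ⬝ P[t₁+t₂ = t₃+t₄ ∣ t₁,t₂,t₃,t₄ ← T] ≤ ω^c(GHZ_4^d)`. -/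
theorem stmt_8 (d : ℕ) (hd : 0 < d) (T : Finset (Fin d → ZMod 4))
    (hT : Set.BijOn
      (fun v : Fin d → ZMod 4 => fun j => ZMod.castHom (by norm_num : (2:ℕ) ∣ 4) (ZMod 2) (v j))
      (T : Set (Fin d → ZMod 4)) Set.univ) :
    linCoeffSet T ≤ ghzValue 4 d ∧
      (2 : ℝ) ^ d * ((((T ×ˢ T ×ˢ T ×ˢ T).filter
          (fun q => q.1 + q.2.1 = q.2.2.1 + q.2.2.2)).card : ℝ) / (T.card : ℝ) ^ 4) ≤
        ghzValue 4 d := by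
  have hcard : T.card = 2 ^ d := by
    have h := Finset.card_nbij (s := T) (t := (Finset.univ : Finset (Fin d → ZMod 2))) _
      (fun v _ => Finset.mem_univ _) hT.injOn (by simpa using hT.surjOn)
    simpa using h
  have hlow := lowBits_injOn hT.injOn
  have main : (2 : ℝ) ^ d * ((((T ×ˢ T ×ˢ T ×ˢ T).filter
      (fun q => q.1 + q.2.1 = q.2.2.1 + q.2.2.2)).card : ℝ) / (T.card : ℝ) ^ 4) ≤
      ghzValue 4 d := by
    classical
    let g : (Fin d → Bool) → (Fin d → ZMod 4) := Function.invFunOn lowBits T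
    have hg : ∀ v ∈ T, g (lowBits v) = v := fun v hv => hlow.leftInvOn_invFunOn hv
    set Q := (T ×ˢ T ×ˢ T ×ˢ T).filter (fun q => q.1 + q.2.1 = q.2.2.1 + q.2.2.2) with hQ
    let f : (Fin d → ZMod 4) × (Fin d → ZMod 4) × (Fin d → ZMod 4) × (Fin d → ZMod 4) →
        Fin 4 → Fin d → Bool :=
      fun q => ![lowBits q.1, lowBits q.2.1, lowBits q.2.2.1, lowBits q.2.2.2]
    have hf : Set.InjOn f Q := by
      rintro ⟨a, b, c, e⟩ hq ⟨a', b', c', e'⟩ hq' h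
      simp only [hQ, Finset.coe_filter, Finset.mem_product, Set.mem_ofPred_eq] at hq hq'
      have h₀ := hlow hq.1.1 hq'.1.1 (congrFun h 0)
      have h₁ := hlow hq.1.2.1 hq'.1.2.1 (congrFun h 1)
      have h₂ := hlow hq.1.2.2.1 hq'.1.2.2.1 (congrFun h 2)
      have h₃ := hlow hq.1.2.2.2 hq'.1.2.2.2 (congrFun h 3)
      simp only [h₀, h₁, h₂, h₃]
    let A : Fin 4 → (Fin d → Bool) → (Fin d → Bool) :=
      ![fun x => highBits (g x), fun x => highBits (g x),
        fun x => highBits (-g x), fun x => highBits (-g x)]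
    let E := Finset.univ.filter fun x : Fin 4 → Fin d → Bool =>
      ∀ j, (∑ i, (if x i j then (1 : ZMod 2) else 0)) = 0
    have hE : ∀ x, (∀ j, (∑ i, (if x i j then (1 : ZMod 2) else 0)) = 0) ↔ x ∈ E := by
      simp [E]
    have hwin := le_ghzValue_of_card A (Q.image f) E hE (by
      intro x hx
      obtain ⟨⟨a, b, c, e⟩, hq, rfl⟩ := Finset.mem_image.1 hx
      simp only [hQ, Finset.mem_filter, Finset.mem_product] at hq
      obtain ⟨⟨ha, hb, hc, he⟩, hsum⟩ := hq
      refine ⟨(hE _).1 fun j => ?_, fun j => ?_⟩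
      · have hj := congrFun hsum j
        simp only [Pi.add_apply] at hj
        have key : ∀ t : ZMod 2, t + t = 0 := by decide
        rw [Fin.sum_univ_four]
        change (if lowBits a j then (1 : ZMod 2) else 0) + (if lowBits b j then 1 else 0) +
          (if lowBits c j then 1 else 0) + (if lowBits e j then 1 else 0) = 0
        simp only [lowBits_eq_castHom]
        rw [← map_add, hj, map_add, add_assoc, key]
      · have hj := congrFun hsum j
        simp only [Pi.add_apply] at hj
        have h₀ := lowBits_add_two_mul_highBits a j
        have h₁ := lowBits_add_two_mul_highBits b j
        have h₂ := lowBits_add_two_mul_highBits (-c) j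
        have h₃ := lowBits_add_two_mul_highBits (-e) j
        rw [lowBits_neg, Pi.neg_apply] at h₂ h₃
        rw [Fin.sum_univ_four, Fin.sum_univ_four]
        change (if lowBits a j then (1 : ZMod 4) else 0) + (if lowBits b j then 1 else 0) +
          (if lowBits c j then 1 else 0) + (if lowBits e j then 1 else 0) +
          2 * ((if highBits (g (lowBits a)) j then 1 else 0) +
            (if highBits (g (lowBits b)) j then 1 else 0) +
            (if highBits (-g (lowBits c)) j then 1 else 0) +
            (if highBits (-g (lowBits e)) j then 1 else 0)) = 0
        rw [hg a ha, hg b hb, hg c hc, hg e he]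
        linear_combination h₀ + h₁ + h₂ + h₃ + hj)
    rw [Finset.card_image_of_injOn hf] at hwin
    refine le_trans ?_ hwin
    have hEcard : (E.card : ℝ) ≤ ((2 : ℝ) ^ d) ^ 3 := by exact_mod_cast card_evenParity_le d E hE
    have hEpos : (0 : ℝ) < E.card :=
      Nat.cast_pos.2 (Finset.card_pos.2 ⟨fun _ _ => false, by simp [E]⟩)
    have hcard' : (T.card : ℝ) = 2 ^ d := by exact_mod_cast hcard
    have hpow : (0 : ℝ) < 2 ^ d := by positivity
    have hQnonneg : (0 : ℝ) ≤ Q.card := Nat.cast_nonneg _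
    rw [hcard']
    generalize (Q.card : ℝ) = m at *
    generalize (2 : ℝ) ^ d = N at *
    calc N * (m / N ^ 4) = m / N ^ 3 := by field_simp
      _ ≤ m / E.card := div_le_div_of_nonneg_left hQnonneg hEpos hEcard
  refine ⟨?_, main⟩
  rw [linCoeffSet_eq]
  exact le_of_eq_of_le (by simp [hcard]) main
end

section
/- Let T be a time-ordered parity-balanced subset of (ℤ/4)^d. Then η(T) ≤ (3/4)^d. -/
/-- A function `f : {0,1}^d → {0,1}^d` is time-ordered if its `i`-th output bit depends only
on the input bits `y₁, …, yᵢ`. -/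
def TimeOrdered {d : ℕ} (f : (Fin d → Bool) → (Fin d → Bool)) : Prop :=
  ∀ i : Fin d, ∀ y y' : Fin d → Bool, (∀ j : Fin d, j ≤ i → y j = y' j) → f y i = f y' i

/-- If membership of a word is decided by constraints `R i` that only look at the letters up to
position `i`, and each constraint leaves at most `n` choices for the letter at position `i`, then
at most `n ^ d` words of length `d` satisfy all the constraints. -/
theorem card_filter_forall_causal_le {A : Type*} [Fintype A] [Inhabited A] (n : ℕ) :
    ∀ (d : ℕ) (R : Fin d → (Fin d → A) → Prop) [∀ i, DecidablePred (R i)],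
      (∀ i q q', (∀ j ≤ i, q j = q' j) → R i q → R i q') →
      (∀ i q, (Finset.univ.filter fun a => R i (Function.update q i a)).card ≤ n) →
      (Finset.univ.filter fun q => ∀ i, R i q).card ≤ n ^ d
  | 0, R, _, _, _ => by
    simp
  | d + 1, R, _, hR, hn => by
    classical
    let R' : Fin d → (Fin d → A) → Prop := fun i p => R i.castSucc (Fin.snoc p default)
    have init_agree (i : Fin d) (q : Fin (d + 1) → A) (a : A) :
        ∀ j ≤ i.castSucc, q j = (Fin.snoc (Fin.init q) a : Fin (d + 1) → A) j := by
      intro j hj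
      obtain ⟨k, rfl⟩ := Fin.exists_castSucc_eq.2
        (lt_of_le_of_lt hj (Fin.castSucc_lt_last i)).ne
      simp [Fin.init]
    have ih : (Finset.univ.filter fun p => ∀ i, R' i p).card ≤ n ^ d := by
      refine card_filter_forall_causal_le n d R' (fun i p p' h => ?_) (fun i p => ?_)
      · refine hR _ _ _ fun j hj => ?_
        obtain ⟨k, rfl⟩ := Fin.exists_castSucc_eq.2
          (lt_of_le_of_lt hj (Fin.castSucc_lt_last i)).ne
        simpa using h k (by simpa using hj)
      · simpa only [R', Fin.snoc_update] using hn i.castSucc (Fin.snoc p default)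
    rw [pow_succ']
    refine (Finset.card_le_mul_card_image_of_maps_to
      (t := Finset.univ.filter fun p => ∀ i, R' i p) (f := Fin.init) (fun q hq => ?_) n
      fun p _ => ?_).trans (Nat.mul_le_mul_left n ih)
    · simp only [Finset.mem_filter, Finset.mem_univ, true_and] at hq ⊢
      exact fun i => hR _ _ _ (init_agree i q default) (hq _)
    · refine le_trans (Finset.card_le_card_of_injOn (fun q => q (Fin.last d)) (fun q hq => ?_)
        fun q hq q' hq' h => ?_) (hn (Fin.last d) (Fin.snoc p default))
      · simp only [Finset.mem_filter, Finset.mem_univ, true_and, Finset.coe_filter,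
          Set.mem_ofPred_eq] at hq ⊢
        rw [Fin.update_snoc_last, ← hq.2, Fin.snoc_init_self]
        exact hq.1 _
      · simp only [Finset.mem_filter, Finset.mem_univ, true_and, Finset.coe_filter,
          Set.mem_ofPred_eq] at hq hq'
        rw [← Fin.snoc_init_self q, ← Fin.snoc_init_self q', hq.2, hq'.2]
        exact congrArg _ h

/-- The element `b + 2c` of `ℤ/4` with binary digits `b` and `c`. -/
def ofBits (b c : Bool) : ZMod 4 :=
  (if b then (1 : ZMod 4) else 0) + 2 * (if c then (1 : ZMod 4) else 0)

theorem ofBits_left_injective {b b' c c' : Bool} (h : ofBits b c = ofBits b' c') : b = b' := by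
  revert b b' c c'
  decide

theorem card_filter_ofBits_cond_le (p₁ r₁ p₂ r₂ p₃ r₃ p₄ r₄ : Bool) :
    (Finset.univ.filter fun a : Bool × Bool × Bool × Bool =>
      ofBits a.1 (cond a.1 p₁ r₁) + ofBits a.2.1 (cond a.2.1 p₂ r₂) =
        ofBits a.2.2.1 (cond a.2.2.1 p₃ r₃) + ofBits a.2.2.2 (cond a.2.2.2 p₄ r₄)).card ≤ 6 := by
  revert p₁ r₁ p₂ r₂ p₃ r₃ p₄ r₄
  decide +kernel

theorem card_filter_ofBits_le (g₁ g₂ g₃ g₄ : Bool → Bool) :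
    (Finset.univ.filter fun a : Bool × Bool × Bool × Bool =>
      ofBits a.1 (g₁ a.1) + ofBits a.2.1 (g₂ a.2.1) =
        ofBits a.2.2.1 (g₃ a.2.2.1) + ofBits a.2.2.2 (g₄ a.2.2.2)).card ≤ 6 := by
  have key (g : Bool → Bool) : g = fun b => cond b (g true) (g false) := by
    ext b
    cases b <;> rfl
  rw [key g₁, key g₂, key g₃, key g₄]
  exact card_filter_ofBits_cond_le ..

theorem linCoeffSet_eq_div {α : Type*} [AddCommGroup α] [DecidableEq α] {S : Finset α}
    (hS : S.Nonempty) :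
    linCoeffSet S = ((S ×ˢ S ×ˢ S ×ˢ S).filter
      (fun q => q.1 + q.2.1 = q.2.2.1 + q.2.2.2)).card / (S.card : ℝ) ^ 3 := by
  have hdiag : ((S ×ˢ S).filter (fun q => q.1 = q.2)).card = S.card := by
    rw [← S.diag_card, Finset.diag_eq_filter]
  have hpos : (S.card : ℝ) ≠ 0 := by exact_mod_cast hS.card_pos.ne'
  rw [linCoeffSet, hdiag]
  field_simp

theorem TimeOrdered.apply_update {d : ℕ} {f : (Fin d → Bool) → (Fin d → Bool)}
    (hf : TimeOrdered f) (i : Fin d) {x y : Fin d → Bool} (h : ∀ j ≠ i, x j = y j) :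
    f x i = f (Function.update y i (x i)) i := by
  refine hf i _ _ fun j _ => ?_
  rcases eq_or_ne j i with rfl | hj
  · simp
  · simpa [hj] using h j hj

/-- The additive energy of a time-ordered parity-balanced set is at most `6 ^ d`. -/
theorem TimeOrdered.card_additive_quadruples_le {d : ℕ} {f : (Fin d → Bool) → (Fin d → Bool)}
    (hf : TimeOrdered f) {T : Finset (Fin d → ZMod 4)}
    (hT : T = Finset.univ.image fun x j => ofBits (x j) (f x j)) :
    ((T ×ˢ T ×ˢ T ×ˢ T).filter (fun q => q.1 + q.2.1 = q.2.2.1 + q.2.2.2)).card ≤ 6 ^ d := by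
  let φ : (Fin d → Bool) → Fin d → ZMod 4 := fun x j => ofBits (x j) (f x j)
  let R : Fin d → (Fin d → Bool × Bool × Bool × Bool) → Prop := fun i q =>
    φ (fun j => (q j).1) i + φ (fun j => (q j).2.1) i =
      φ (fun j => (q j).2.2.1) i + φ (fun j => (q j).2.2.2) i
  have : ∀ i, DecidablePred (R i) := fun i q => inferInstanceAs (Decidable (_ = _))
  have hφ (i : Fin d) (x y : Fin d → Bool) (h : ∀ j ≤ i, x j = y j) : φ x i = φ y i := by
    simp only [φ, h i le_rfl, hf i x y h]
  refine le_trans ?_ (card_filter_forall_causal_le 6 d R (fun i q q' h hq => ?_) fun i q => ?_)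
  · refine (Finset.card_le_card fun t ht => ?_).trans (Finset.card_image_le
      (f := fun q : Fin d → Bool × Bool × Bool × Bool =>
        (φ fun j => (q j).1, φ fun j => (q j).2.1,
          φ fun j => (q j).2.2.1, φ fun j => (q j).2.2.2)))
    obtain ⟨t₁, t₂, t₃, t₄⟩ := t
    simp only [hT, Finset.mem_filter, Finset.mem_product, Finset.mem_image, Finset.mem_univ,
      true_and] at ht
    obtain ⟨⟨⟨x, rfl⟩, ⟨y, rfl⟩, ⟨z, rfl⟩, ⟨w, rfl⟩⟩, hsum⟩ := ht
    refine Finset.mem_image.2 ⟨fun j => (x j, y j, z j, w j), ?_, rfl⟩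
    simp only [Finset.mem_filter, Finset.mem_univ, true_and]
    exact fun i => congrFun hsum i
  · simp only [R] at hq ⊢
    have agree (π : Bool × Bool × Bool × Bool → Bool) :
        φ (fun j => π (q' j)) i = φ (fun j => π (q j)) i :=
      hφ i (fun j => π (q' j)) (fun j => π (q j)) fun j hj => by rw [h j hj]
    rwa [agree Prod.fst, agree fun a => a.2.1, agree fun a => a.2.2.1, agree fun a => a.2.2.2]
  · have upd (π : Bool × Bool × Bool × Bool → Bool) (a : Bool × Bool × Bool × Bool) :
        φ (fun j => π (Function.update q i a j)) i =
          ofBits (π a) (f (Function.update (fun j => π (q j)) i (π a)) i) := by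
      simp only [φ, Function.update_self]
      rw [hf.apply_update i (y := fun j => π (q j)) fun j hj => by simp [hj]]
      simp
    simp only [R, upd Prod.fst, upd fun a => a.2.1, upd fun a => a.2.2.1, upd fun a => a.2.2.2]
    exact card_filter_ofBits_le
      (fun b => f (Function.update (fun j => (q j).1) i b) i)
      (fun b => f (Function.update (fun j => (q j).2.1) i b) i)
      (fun b => f (Function.update (fun j => (q j).2.2.1) i b) i)
      (fun b => f (Function.update (fun j => (q j).2.2.2) i b) i)

/-- If `T ⊆ (ℤ/4)^d` is a time-ordered parity-balanced subset, i.e.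
`T = { x + 2·f(x) : x ∈ {0,1}^d }` for a time-ordered `f : {0,1}^d → {0,1}^d`, then
`η(T) ≤ (3/4)^d`. -/
theorem stmt_9 (d : ℕ) (hd : 0 < d) (f : (Fin d → Bool) → (Fin d → Bool))
    (hf : TimeOrdered f) (T : Finset (Fin d → ZMod 4))
    (hT : T = Finset.image (fun x : Fin d → Bool => fun j =>
      (if x j then (1 : ZMod 4) else 0) + 2 * (if f x j then (1 : ZMod 4) else 0))
      Finset.univ) :
    linCoeffSet T ≤ (3 / 4 : ℝ) ^ d := by
  have hcard : T.card = 2 ^ d := by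
    rw [hT, Finset.card_image_of_injective]
    · simp
    · exact fun x y h => funext fun j => ofBits_left_injective (congrFun h j)
  have hne : T.Nonempty := Finset.card_pos.1 (by simp [hcard])
  have hE : (((T ×ˢ T ×ˢ T ×ˢ T).filter
      (fun q => q.1 + q.2.1 = q.2.2.1 + q.2.2.2)).card : ℝ) ≤ 6 ^ d := by
    exact_mod_cast hf.card_additive_quadruples_le hT
  rw [linCoeffSet_eq_div hne, hcard, div_le_iff₀ (by positivity)]
  refine hE.trans_eq ?_
  push_cast
  rw [← pow_mul, mul_comm d 3, pow_mul, ← mul_pow]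
  norm_num
end

section
/- Let d be a positive integer. For every deterministic strategy (S,T) for the game J_d, the absolute value of the expected score satisfies |ω(J_d,(S,T))| ≤ 2 · (ω^c(GHZ_4^d))^{1/4}. Consequently the classical bias of J_d satisfies β^c(J_d) ≤ 2 · (ω^c(GHZ_4^d))^{1/4}. -/
/-- The score in game `J_d` on inputs `x, y` and outputs `a, b`:  with
`uᵢ = xᵢ·(−1)^{aᵢ}` and `vᵢ = yᵢ + 2bᵢ` in `ℤ/4`, the score is `+1` if
`u·v ≡ 0 or 1 (mod 4)` and `−1` otherwise. -/
noncomputable def jScore (d : ℕ) (x y a b : Fin (d + 1) → Bool) : ℝ :=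
  let u : Fin (d + 1) → ZMod 4 := fun i => (if x i then 1 else 0) * (if a i then -1 else 1)
  let v : Fin (d + 1) → ZMod 4 := fun i => (if y i then 1 else 0) + 2 * (if b i then 1 else 0)
  if (∑ i, u i * v i) = 0 ∨ (∑ i, u i * v i) = 1 then 1 else -1

/-- The inputs of game `J_d`: bit strings of length `d+1` whose last bit is `1`. -/
def jInputs (d : ℕ) : Finset (Fin (d + 1) → Bool) :=
  Finset.univ.filter (fun x => x (Fin.last d) = true)

/-- The expected score `ω(J_d, (S,T))` of the deterministic strategy `(S, T)` for game `J_d`,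
over inputs `x, y` uniform among bit strings with last bit `1`. -/
noncomputable def jExp (d : ℕ) (S T : (Fin (d + 1) → Bool) → (Fin (d + 1) → Bool)) : ℝ :=
  (∑ x ∈ jInputs d, ∑ y ∈ jInputs d, jScore d x y (S x) (T y)) / ((jInputs d).card : ℝ) ^ 2

open scoped ComplexConjugate

/-- The additive character `z ↦ i ^ z` of `ℤ/4`. -/
noncomputable def quarticChar : AddChar (ZMod 4) ℂ :=
  AddChar.zmodChar 4 (ζ := Complex.I) Complex.I_pow_four

lemma quarticChar_one : quarticChar 1 = Complex.I := by
  rw [quarticChar, AddChar.zmodChar_apply]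
  exact pow_one _

lemma quarticChar_two : quarticChar 2 = -1 := by
  rw [quarticChar, AddChar.zmodChar_apply]
  exact Complex.I_sq

lemma quarticChar_three : quarticChar 3 = -Complex.I := by
  rw [quarticChar, AddChar.zmodChar_apply]
  exact Complex.I_pow_three

lemma conj_quarticChar (z : ZMod 4) : conj (quarticChar z) = quarticChar (-z) :=
  (AddChar.map_neg_eq_conj _ _).symm

lemma sum_quarticChar_mul (c : ZMod 4) :
    ∑ z, quarticChar (c * z) = if c = 0 then 4 else 0 := by
  have h22 : (2 * 2 : ZMod 4) = 0 := by decide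
  have h23 : (2 * 3 : ZMod 4) = 2 := by decide
  have h32 : (3 * 2 : ZMod 4) = 2 := by decide
  have h33 : (3 * 3 : ZMod 4) = 1 := by decide
  have hsum : ∀ f : ZMod 4 → ℂ, ∑ z, f z = f 0 + f 1 + f 2 + f 3 := Fin.sum_univ_four
  have hc : c = 0 ∨ c = 1 ∨ c = 2 ∨ c = 3 := by revert c; decide
  have h1 : (1 : ZMod 4) ≠ 0 := by decide
  have h2 : (2 : ZMod 4) ≠ 0 := by decide
  have h3 : (3 : ZMod 4) ≠ 0 := by decide
  rw [hsum]
  rcases hc with rfl | rfl | rfl | rfl <;>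
    simp [h22, h23, h32, h33, h1, h2, h3, quarticChar_one, quarticChar_two, quarticChar_three]
  norm_num

lemma sum_quarticChar_dot {ι : Type*} [Fintype ι] [DecidableEq ι] (c : ι → ZMod 4) :
    ∑ w : ι → ZMod 4, quarticChar (∑ j, c j * w j) =
      if ∀ j, c j = 0 then (4 : ℂ) ^ Fintype.card ι else 0 := by
  have hchar : ∀ w : ι → ZMod 4,
      quarticChar (∑ j, c j * w j) = ∏ j, quarticChar (c j * w j) := fun w =>
    map_prod quarticChar.toMonoidHom (fun j => Multiplicative.ofAdd (c j * w j)) Finset.univ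
  simp_rw [hchar]
  rw [← Fintype.prod_sum (fun j z => quarticChar (c j * z))]
  simp_rw [sum_quarticChar_mul]
  split_ifs with h
  · simp [h]
  · push Not at h
    obtain ⟨j, hj⟩ := h
    exact Finset.prod_eq_zero (Finset.mem_univ j) (if_neg hj)

/-- The fourth moment of an exponential sum over `(ℤ/4)^ι` is at most the additive energy of its
frequencies. -/
lemma sum_norm_pow_four_le {ι X : Type*} [Fintype ι] [DecidableEq ι] [Fintype X] [DecidableEq X]
    (u : X → ι → ZMod 4) (s : X → ℂ) (hs : ∀ x, ‖s x‖ ≤ 1) :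
    ∑ w : ι → ZMod 4, ‖∑ x, s x * quarticChar (∑ j, u x j * w j)‖ ^ 4 ≤
      4 ^ Fintype.card ι * ((Finset.univ.filter (fun x : Fin 4 → X =>
        ∀ j, u (x 0) j + u (x 1) j - u (x 2) j - u (x 3) j = 0)).card : ℝ) := by
  set φ : (ι → ZMod 4) → X → ℂ := fun w x => s x * quarticChar (∑ j, u x j * w j) with hφ
  have key : ((∑ w, ‖∑ x, φ w x‖ ^ 4 : ℝ) : ℂ) =
      ∑ x : Fin 4 → X, (s (x 0) * s (x 1) * conj (s (x 2)) * conj (s (x 3))) *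
        if ∀ j, u (x 0) j + u (x 1) j - u (x 2) j - u (x 3) j = 0 then
          (4 : ℂ) ^ Fintype.card ι else 0 := by
    have expand : ∀ w, ((‖∑ x, φ w x‖ ^ 4 : ℝ) : ℂ) =
        ∑ x : Fin 4 → X, φ w (x 0) * φ w (x 1) * conj (φ w (x 2)) * conj (φ w (x 3)) := by
      intro w
      have h := Fintype.prod_sum (fun (i : Fin 4) (x : X) =>
        (![φ w x, φ w x, conj (φ w x), conj (φ w x)] : Fin 4 → ℂ) i)
      simp only [Fin.prod_univ_four, Matrix.cons_val] at h
      rw [← h, ← map_sum]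
      have h2 := Complex.mul_conj' (∑ x, φ w x)
      push_cast
      linear_combination (-(∑ x, φ w x) * conj (∑ x, φ w x) - (‖∑ x, φ w x‖ : ℂ) ^ 2) * h2
    push_cast at expand ⊢
    simp_rw [expand]
    rw [Finset.sum_comm]
    refine Finset.sum_congr rfl fun x _ => ?_
    rw [← sum_quarticChar_dot, Finset.mul_sum]
    refine Finset.sum_congr rfl fun w _ => ?_
    simp only [hφ, map_mul, conj_quarticChar]
    have : (∑ j, (u (x 0) j + u (x 1) j - u (x 2) j - u (x 3) j) * w j) =
        (∑ j, u (x 0) j * w j) + (∑ j, u (x 1) j * w j) + -(∑ j, u (x 2) j * w j) +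
          -(∑ j, u (x 3) j * w j) := by
      simp only [sub_mul, add_mul, Finset.sum_sub_distrib, Finset.sum_add_distrib]
      ring
    rw [this, AddChar.map_add_eq_mul, AddChar.map_add_eq_mul, AddChar.map_add_eq_mul]
    ring
  have hnonneg : 0 ≤ ∑ w, ‖∑ x, φ w x‖ ^ 4 := by positivity
  rw [← abs_of_nonneg hnonneg, ← Real.norm_eq_abs, ← Complex.norm_real, key]
  refine (norm_sum_le _ _).trans ?_
  rw [mul_comm, ← nsmul_eq_mul, ← Finset.sum_const, Finset.sum_filter]
  refine Finset.sum_le_sum fun x _ => ?_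
  rw [norm_mul]
  have hle : ‖s (x 0) * s (x 1) * conj (s (x 2)) * conj (s (x 3))‖ ≤ 1 := by
    simp only [norm_mul, RCLike.norm_conj]
    exact mul_le_one₀ (mul_le_one₀ (mul_le_one₀ (hs _) (norm_nonneg _) (hs _))
      (norm_nonneg _) (hs _)) (norm_nonneg _) (hs _)
  split_ifs
  · simpa using hle
  · simp

/-- Exactly `8 ^ d` question tuples of the 4-player game have coordinatewise even parity. -/
lemma card_even_parity (d : ℕ) :
    (Finset.univ.filter (fun x : Fin 4 → Fin d → Bool =>
      ∀ j, (∑ i, (if x i j then (1 : ZMod 2) else 0)) = 0)).card = 8 ^ d := by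
  have h8 : (Finset.univ.filter (fun b : Fin 4 → Bool =>
      (∑ i, (if b i then (1 : ZMod 2) else 0)) = 0)).card = 8 := by decide
  have h := Fintype.card_piFinset (fun _ : Fin d => Finset.univ.filter (fun b : Fin 4 → Bool =>
      (∑ i, (if b i then (1 : ZMod 2) else 0)) = 0))
  simp only [h8, Finset.prod_const, Finset.card_univ, Fintype.card_fin] at h
  rw [← h]
  refine Finset.card_equiv (Equiv.piComm _) fun x => ?_
  simp [Fintype.mem_piFinset]

/-- The element `x · (-1) ^ a` of `ℤ/4`. -/
def signedBit (x a : Bool) : ZMod 4 := (if x then 1 else 0) * (if a then -1 else 1)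

lemma signedBit_sum_eq_zero_iff (x₀ x₁ x₂ x₃ a₀ a₁ a₂ a₃ : Bool) :
    signedBit x₀ a₀ + signedBit x₁ a₁ - signedBit x₂ a₂ - signedBit x₃ a₃ = 0 ↔
      ((if x₀ then (1 : ZMod 2) else 0) + (if x₁ then 1 else 0) + (if x₂ then 1 else 0) +
          (if x₃ then 1 else 0) = 0) ∧
        ((if x₀ then (1 : ZMod 4) else 0) + (if x₁ then 1 else 0) + (if x₂ then 1 else 0) +
            (if x₃ then 1 else 0)) +
          2 * ((if x₀ && (xor a₀ false) then (1 : ZMod 4) else 0) +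
            (if x₁ && (xor a₁ false) then 1 else 0) + (if x₂ && (xor a₂ true) then 1 else 0) +
            (if x₃ && (xor a₃ true) then 1 else 0)) = 0 := by
  revert x₀ x₁ x₂ x₃ a₀ a₁ a₂ a₃
  decide

/-- The additive energy of the signed bit strings produced by any single strategy is a lower bound
for the winning count in `GHZ_4^d`. -/
lemma energy_le_ghzValue (d : ℕ) (a : (Fin d → Bool) → Fin d → Bool) :
    ((Finset.univ.filter (fun x : Fin 4 → Fin d → Bool =>
        ∀ j, signedBit (x 0 j) (a (x 0) j) + signedBit (x 1 j) (a (x 1) j) -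
          signedBit (x 2 j) (a (x 2) j) - signedBit (x 3 j) (a (x 3) j) = 0)).card : ℝ) ≤
      8 ^ d * ghzValue 4 d := by
  classical
  have hval := le_ciSup (f := fun A : Fin 4 → (Fin d → Bool) → (Fin d → Bool) =>
    (((Finset.univ.filter (fun x : Fin 4 → Fin d → Bool =>
        (∀ j, (∑ i, (if x i j then (1 : ZMod 2) else 0)) = 0) ∧
        (∀ j, (∑ i, (if x i j then (1 : ZMod 4) else 0)) +
            2 * (∑ i, (if A i (x i) j then (1 : ZMod 4) else 0)) = 0))).card : ℝ) /
      ((Finset.univ.filter (fun x : Fin 4 → Fin d → Bool =>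
        ∀ j, (∑ i, (if x i j then (1 : ZMod 2) else 0)) = 0)).card : ℝ)))
    (Set.finite_range _).bddAbove
    (fun i x j => x j && xor (a x j) (decide (2 ≤ i)))
  have hcard := card_even_parity d
  have h8 : (0 : ℝ) < 8 ^ d := by positivity
  rw [mul_comm, ← div_le_iff₀ h8]
  refine le_trans (le_of_eq ?_) (hval.trans (le_of_eq ?_))
  · simp only
    congr 2
    · congr 1
      ext x
      simp only [Finset.mem_filter, Finset.mem_univ, true_and, ← forall_and]
      refine forall_congr' fun j => ?_
      simp only [Fin.sum_univ_four]
      exact signedBit_sum_eq_zero_iff _ _ _ _ _ _ _ _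
    · rw [← Nat.cast_ofNat (n := 8), ← Nat.cast_pow, ← hcard]
  · unfold ghzValue
    congr!

lemma sum_jInputs (d : ℕ) (f : (Fin (d + 1) → Bool) → ℝ) :
    ∑ x ∈ jInputs d, f x = ∑ x : Fin d → Bool, f (Fin.snoc x true) := by
  symm
  refine Finset.sum_bij' (fun x _ => Fin.snoc (α := fun _ => Bool) x true)
    (fun x _ => Fin.init x) ?_ ?_ ?_ ?_ ?_
  · intro x _
    simp [jInputs]
  · simp
  · simp
  · intro x hx
    have hx' : x (Fin.last d) = true := by simpa [jInputs] using hx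
    rw [← hx', Fin.snoc_init_self]
  · simp

lemma card_jInputs (d : ℕ) : ((jInputs d).card : ℝ) = 2 ^ d := by
  have h := sum_jInputs d fun _ => 1
  simpa using h

lemma quarter_score (z : ZMod 4) :
    (if z = 0 ∨ z = 1 then (1 : ℝ) else -1) = ((1 - Complex.I) * quarticChar z).re := by
  have hz : z = 0 ∨ z = 1 ∨ z = 2 ∨ z = 3 := by revert z; decide
  have h1 : (1 : ZMod 4) ≠ 0 := by decide
  have h2 : ¬((2 : ZMod 4) = 0 ∨ (2 : ZMod 4) = 1) := by decide
  have h3 : ¬((3 : ZMod 4) = 0 ∨ (3 : ZMod 4) = 1) := by decide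
  rcases hz with rfl | rfl | rfl | rfl
  · simp
  · simp [quarticChar_one]
  · rw [if_neg h2]; simp [quarticChar_two]
  · rw [if_neg h3]; simp [quarticChar_three]

/-- The element `y + 2b` of `ℤ/4`. -/
def shiftedBit (y b : Bool) : ZMod 4 := (if y then 1 else 0) + 2 * (if b then 1 else 0)

lemma quarticChar_last (a b : Bool) :
    quarticChar (signedBit true a * shiftedBit true b) =
      (if a then -1 else 1) * ((if b then -1 else 1) * Complex.I) := by
  have h1 : (1 + 2 : ZMod 4) = 3 := by decide
  have h2 : (-1 + -2 : ZMod 4) = 1 := by decide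
  have h3 : (-1 : ZMod 4) = 3 := by decide
  cases a <;> cases b <;>
    simp [signedBit, shiftedBit, h1, quarticChar_one, quarticChar_three, AddChar.map_neg_eq_inv]

lemma jScore_snoc (d : ℕ) (x y : Fin d → Bool) (a b : Fin (d + 1) → Bool) :
    jScore d (Fin.snoc x true) (Fin.snoc y true) a b =
      ((1 - Complex.I) * ((if b (Fin.last d) then -1 else 1) * Complex.I) *
        ((if a (Fin.last d) then -1 else 1) * quarticChar (∑ j, signedBit (x j) (a j.castSucc) *
          shiftedBit (y j) (b j.castSucc)))).re := by
  unfold jScore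
  rw [quarter_score]
  congr 1
  rw [Fin.sum_univ_castSucc, AddChar.map_add_eq_mul]
  have h := quarticChar_last (a (Fin.last d)) (b (Fin.last d))
  unfold signedBit shiftedBit at h ⊢
  simp only [Fin.snoc_castSucc, Fin.snoc_last, ↓reduceIte] at h ⊢
  rw [h]
  ring

lemma shiftedBit_inj {y y' b b' : Bool} (h : shiftedBit y b = shiftedBit y' b') : y = y' := by
  revert y y' b b'
  decide

lemma norm_one_sub_I_le : ‖(1 - Complex.I : ℂ)‖ ≤ 2 := by
  refine (norm_sub_le _ _).trans ?_
  norm_num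

lemma abs_jExp_pow_four_le (d : ℕ) (S T : (Fin (d + 1) → Bool) → (Fin (d + 1) → Bool)) :
    |jExp d S T| ^ 4 ≤ 16 * ghzValue 4 d := by
  set a : (Fin d → Bool) → Fin d → Bool := fun x j => S (Fin.snoc x true) j.castSucc with ha
  set s : (Fin d → Bool) → ℂ := fun x => if S (Fin.snoc x true) (Fin.last d) then -1 else 1 with hs
  set v : (Fin d → Bool) → Fin d → ZMod 4 := fun y j =>
    shiftedBit (y j) (T (Fin.snoc y true) j.castSucc) with hv
  set F : (Fin d → ZMod 4) → ℂ := fun w =>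
    ∑ x, s x * quarticChar (∑ j, signedBit (x j) (a x j) * w j) with hF
  have hsum : |∑ x ∈ jInputs d, ∑ y ∈ jInputs d, jScore d x y (S x) (T y)| ≤
      2 * ∑ y, ‖F (v y)‖ := by
    rw [Finset.sum_comm, sum_jInputs, Finset.mul_sum]
    refine (Finset.abs_sum_le_sum_abs _ _).trans (Finset.sum_le_sum fun y _ => ?_)
    rw [sum_jInputs]
    simp_rw [jScore_snoc]
    rw [← Complex.re_sum, ← Finset.mul_sum]
    refine (Complex.abs_re_le_norm _).trans ?_
    rw [norm_mul]
    refine mul_le_mul_of_nonneg_right ?_ (norm_nonneg _)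
    rw [norm_mul]
    refine le_trans (le_of_eq ?_) norm_one_sub_I_le
    split_ifs <;> simp
  have hmean : (∑ y, ‖F (v y)‖) ^ 4 ≤ 8 ^ d * ∑ y, ‖F (v y)‖ ^ 4 := by
    have h := pow_sum_div_card_le_sum_pow (s := Finset.univ) (f := fun y => ‖F (v y)‖)
      (fun _ _ => norm_nonneg _) 3
    rw [Finset.card_univ, Fintype.card_fun, Fintype.card_bool, Fintype.card_fin,
      div_le_iff₀ (by positivity)] at h
    refine h.trans_eq ?_
    push_cast
    rw [mul_comm, ← pow_mul, mul_comm d, pow_mul]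
    norm_num
  have hinj : Function.Injective v := fun y y' h =>
    funext fun j => shiftedBit_inj (congrFun h j)
  have hsub : ∑ y, ‖F (v y)‖ ^ 4 ≤ ∑ w, ‖F w‖ ^ 4 := by
    rw [← Finset.sum_image (f := fun w => ‖F w‖ ^ 4) (g := v) hinj.injOn]
    exact Finset.sum_le_sum_of_subset_of_nonneg (Finset.subset_univ _) fun _ _ _ => by positivity
  have henergy := sum_norm_pow_four_le (fun (x : Fin d → Bool) j => signedBit (x j) (a x j)) s
    (fun x => by simp only [hs]; split_ifs <;> simp)
  rw [Fintype.card_fin] at henergy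
  have hghz := energy_le_ghzValue d a
  have htotal : (∑ y, ‖F (v y)‖) ^ 4 ≤ 256 ^ d * ghzValue 4 d := calc
    _ ≤ 8 ^ d * (4 ^ d * (8 ^ d * ghzValue 4 d)) := by
      refine hmean.trans (mul_le_mul_of_nonneg_left ?_ (by positivity))
      exact hsub.trans (henergy.trans (mul_le_mul_of_nonneg_left
        (le_of_eq_of_le (by congr!) hghz) (by positivity)))
    _ = _ := by
      rw [← mul_assoc, ← mul_assoc, ← mul_pow, ← mul_pow]
      norm_num
  unfold jExp
  rw [card_jInputs, abs_div, div_pow]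
  have hden : |((2 : ℝ) ^ d) ^ 2| ^ 4 = 256 ^ d := by
    rw [abs_of_pos (by positivity), ← pow_mul, ← pow_mul, mul_comm d, pow_mul]
    norm_num
  rw [hden, div_le_iff₀ (by positivity)]
  calc _ ≤ (2 * ∑ y, ‖F (v y)‖) ^ 4 := pow_le_pow_left₀ (abs_nonneg _) hsum 4
    _ = 16 * (∑ y, ‖F (v y)‖) ^ 4 := by ring
    _ ≤ 16 * (256 ^ d * ghzValue 4 d) := by gcongr
    _ = _ := by ring

/-- Every deterministic strategy `(S,T)` for game `J_d` satisfies
`|ω(J_d,(S,T))| ≤ 2 ω^c(GHZ_4^d)^{1/4}`; consequently the classical bias of `J_d` is at most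
`2 ω^c(GHZ_4^d)^{1/4}`. -/
theorem stmt_12 (d : ℕ) (hd : 0 < d) :
    (∀ S T : (Fin (d + 1) → Bool) → (Fin (d + 1) → Bool),
      |jExp d S T| ≤ 2 * ghzValue 4 d ^ ((1 : ℝ) / 4)) ∧
    (⨆ p : ((Fin (d + 1) → Bool) → (Fin (d + 1) → Bool)) ×
        ((Fin (d + 1) → Bool) → (Fin (d + 1) → Bool)), |jExp d p.1 p.2|) ≤
      2 * ghzValue 4 d ^ ((1 : ℝ) / 4) := by
  have main : ∀ S T : (Fin (d + 1) → Bool) → (Fin (d + 1) → Bool),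
      |jExp d S T| ≤ 2 * ghzValue 4 d ^ ((1 : ℝ) / 4) := by
    intro S T
    have h := abs_jExp_pow_four_le d S T
    have hnonneg : 0 ≤ ghzValue 4 d := by
      have := pow_nonneg (abs_nonneg (jExp d S T)) 4
      linarith
    refine le_of_pow_le_pow_left₀ four_ne_zero (by positivity) (h.trans_eq ?_)
    rw [mul_pow, ← Real.rpow_mul_natCast hnonneg]
    norm_num
  exact ⟨main, ciSup_le fun p => main p.1 p.2⟩
end

section
/- Let S, T be finite nonempty sets, F : S × T → [−1,1] a function, and α a positive integer. Let Λ = max_{s∈S} (Σ_{t∈T} F(s,t))/|T|. Let t₁,…,t_α be independent uniform samples from T and let Λ' = max_{s∈S} (F(s,t₁)+⋯+F(s,t_α))/α. Then |E[Λ'] − Λ| ≤ (2 + √(log α + 2·log|S|))/√α. -/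
open MeasureTheory ProbabilityTheory in
/-- Hoeffding's lemma for the uniform distribution on a finite type. -/
lemma sum_exp_le_of_mem_Icc {T : Type*} [Fintype T] [Nonempty T]
    (f : T → ℝ) (hf : ∀ t, f t ∈ Set.Icc (-1 : ℝ) 1) (l : ℝ) :
    ∑ t, Real.exp (l * f t) ≤
      Fintype.card T * Real.exp (l * ((∑ t, f t) / Fintype.card T) + l ^ 2 / 2) := by
  let _ : MeasurableSpace T := ⊤
  have hT : (0 : ℝ) < Fintype.card T := by exact_mod_cast Fintype.card_pos
  let μ := (PMF.uniformOfFintype T).toMeasure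
  have hint (g : T → ℝ) : ∫ t, g t ∂μ = (∑ t, g t) / Fintype.card T := by
    rw [PMF.integral_eq_sum]
    simp [div_eq_inv_mul, Finset.mul_sum]
  have h := (hasSubgaussianMGF_of_mem_Icc (μ := μ) (X := f) (a := -1) (b := 1)
    (measurable_from_top.aemeasurable) (ae_of_all _ hf)).mgf_le l
  rw [mgf, hint, hint, div_le_iff₀ hT] at h
  have e (t : T) : Real.exp (l * f t) =
      Real.exp (l * (f t - (∑ t, f t) / Fintype.card T)) *
        Real.exp (l * ((∑ t, f t) / Fintype.card T)) := by
    rw [← Real.exp_add]; ring_nf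
  rw [Finset.sum_congr rfl fun t _ => e t, ← Finset.sum_mul]
  refine (mul_le_mul_of_nonneg_right h (Real.exp_pos _).le).trans_eq ?_
  rw [Real.exp_add]
  norm_num
  ring_nf

/-- Exponential moment bound for a sum of independent uniform samples. -/
lemma sum_exp_sum_le_of_mem_Icc {T : Type*} [Fintype T] [Nonempty T]
    (f : T → ℝ) (hf : ∀ t, f t ∈ Set.Icc (-1 : ℝ) 1) (l : ℝ) (n : ℕ) :
    ∑ t : Fin n → T, Real.exp (l * ∑ i, f (t i)) ≤
      (Fintype.card T : ℝ) ^ n *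
        Real.exp (n * (l * ((∑ t, f t) / Fintype.card T) + l ^ 2 / 2)) := by
  have h := pow_le_pow_left₀ (by positivity) (sum_exp_le_of_mem_Icc f hf l) n
  rw [mul_pow, ← Real.exp_nat_mul] at h
  refine le_trans (le_of_eq ?_) h
  rw [Fintype.sum_pow]
  simp [Finset.mul_sum, Real.exp_sum]

/-- Upper bound on the expected empirical maximum, by a union bound on exponential moments. -/
lemma sum_sup'_div_le {S T : Type*} [Fintype S] [Fintype T] [Nonempty S] [Nonempty T]
    (F : S → T → ℝ) (hF : ∀ s t, F s t ∈ Set.Icc (-1 : ℝ) 1) (n : ℕ) (hn : 0 < n)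
    {l : ℝ} (hl : 0 < l) :
    (∑ t : Fin n → T,
        Finset.univ.sup' Finset.univ_nonempty (fun s : S => (∑ i, F s (t i)) / (n : ℝ))) /
          ((Fintype.card T : ℝ) ^ n) ≤
      Finset.univ.sup' Finset.univ_nonempty
        (fun s : S => (∑ t, F s t) / (Fintype.card T : ℝ)) +
      (Real.log (Fintype.card S) / (l * n) + l / 2) := by
  set A : (Fin n → T) → ℝ := fun t =>
    Finset.univ.sup' Finset.univ_nonempty (fun s : S => (∑ i, F s (t i)) / (n : ℝ)) with hA
  set M := Finset.univ.sup' Finset.univ_nonempty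
        (fun s : S => (∑ t, F s t) / (Fintype.card T : ℝ)) with hM
  have hn' : (0 : ℝ) < n := by exact_mod_cast hn
  have hT : (0 : ℝ) < (Fintype.card T : ℝ) ^ n := pow_pos (by exact_mod_cast Fintype.card_pos) n
  have hS : (0 : ℝ) < Fintype.card S := by exact_mod_cast Fintype.card_pos
  set c := Real.log (Fintype.card S) + n * (l * M + l ^ 2 / 2) with hc
  have hexp : ∑ t, Real.exp (l * n * A t) ≤ (Fintype.card T : ℝ) ^ n * Real.exp c := by
    calc ∑ t, Real.exp (l * n * A t)
        ≤ ∑ t : Fin n → T, ∑ s, Real.exp (l * ∑ i, F s (t i)) := by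
          refine Finset.sum_le_sum fun t _ => ?_
          obtain ⟨s, -, hs⟩ := Finset.exists_mem_eq_sup' Finset.univ_nonempty
            (fun s : S => (∑ i, F s (t i)) / (n : ℝ))
          have : l * n * A t = l * ∑ i, F s (t i) := by
            simp only [hA]; rw [hs]; field_simp
          rw [this]
          exact Finset.single_le_sum (f := fun s => Real.exp (l * ∑ i, F s (t i)))
            (fun _ _ => (Real.exp_pos _).le) (Finset.mem_univ s)
      _ = ∑ s, ∑ t : Fin n → T, Real.exp (l * ∑ i, F s (t i)) := Finset.sum_comm
      _ ≤ ∑ _s : S, (Fintype.card T : ℝ) ^ n * Real.exp (n * (l * M + l ^ 2 / 2)) := by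
          refine Finset.sum_le_sum fun s _ => (sum_exp_sum_le_of_mem_Icc _ (hF s) l n).trans ?_
          gcongr
          exact Finset.le_sup' (fun s : S => (∑ t, F s t) / (Fintype.card T : ℝ))
            (Finset.mem_univ s)
      _ = (Fintype.card T : ℝ) ^ n * Real.exp c := by
          rw [hc, Real.exp_add, Real.exp_log hS]
          simp
          ring
  have hlin : ∑ t, (l * n * A t - c + 1) ≤ (Fintype.card T : ℝ) ^ n := by
    calc ∑ t, (l * n * A t - c + 1) ≤ ∑ t, Real.exp (l * n * A t) * Real.exp (-c) := by
          refine Finset.sum_le_sum fun t _ => ?_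
          rw [← Real.exp_add, ← sub_eq_add_neg]
          exact Real.add_one_le_exp _
      _ ≤ (Fintype.card T : ℝ) ^ n * Real.exp c * Real.exp (-c) := by
          rw [← Finset.sum_mul]
          gcongr
      _ = (Fintype.card T : ℝ) ^ n := by
          rw [mul_assoc, ← Real.exp_add]; simp
  rw [Finset.sum_add_distrib, Finset.sum_sub_distrib, ← Finset.mul_sum] at hlin
  simp only [Finset.sum_const, Finset.card_univ, Fintype.card_fun, Fintype.card_fin,
    nsmul_eq_mul, Nat.cast_pow, mul_one] at hlin
  have key : l * n * ∑ t, A t ≤ (Fintype.card T : ℝ) ^ n * c := by linarith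
  rw [div_le_iff₀ hT]
  have : M + (Real.log (Fintype.card S) / (l * n) + l / 2) = c / (l * n) := by
    rw [hc]; field_simp; ring
  rw [this, div_mul_eq_mul_div, le_div_iff₀ (by positivity)]
  linarith

/-- The expected empirical maximum is at least the maximal mean. -/
lemma sup'_le_sum_sup'_div {S T : Type*} [Fintype S] [Fintype T] [Nonempty S] [Nonempty T]
    (F : S → T → ℝ) (n : ℕ) (hn : 0 < n) :
    Finset.univ.sup' Finset.univ_nonempty
        (fun s : S => (∑ t, F s t) / (Fintype.card T : ℝ)) ≤
    (∑ t : Fin n → T,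
        Finset.univ.sup' Finset.univ_nonempty (fun s : S => (∑ i, F s (t i)) / (n : ℝ))) /
          ((Fintype.card T : ℝ) ^ n) := by
  have hn' : (0 : ℝ) < n := by exact_mod_cast hn
  have hT : (0 : ℝ) < Fintype.card T := by exact_mod_cast Fintype.card_pos
  refine Finset.sup'_le _ _ fun s _ => ?_
  have hsum : ∑ t : Fin n → T, (∑ i, F s (t i)) / (n : ℝ) =
      (Fintype.card T : ℝ) ^ (n - 1) * ∑ t, F s t := by
    rw [← Finset.sum_div, Finset.sum_comm]
    have h (i : Fin n) : ∑ t : Fin n → T, F s (t i) =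
        (Fintype.card T : ℝ) ^ (n - 1) * ∑ t, F s t := by
      classical
      simpa using Fintype.sum_piFinset_apply (F s) Finset.univ i
    simp only [h, Finset.sum_const, Finset.card_univ, Fintype.card_fin, nsmul_eq_mul]
    field_simp
  calc (∑ t, F s t) / (Fintype.card T : ℝ)
      = (∑ t : Fin n → T, (∑ i, F s (t i)) / (n : ℝ)) / (Fintype.card T : ℝ) ^ n := by
        rw [hsum, ← mul_pow_sub_one hn.ne' (Fintype.card T : ℝ)]
        field_simp
    _ ≤ _ := by
        gcongr with t
        exact Finset.le_sup' (fun s : S => (∑ i, F s (t i)) / (n : ℝ)) (Finset.mem_univ s)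


/-- sampling proposition.  For finite nonempty `S, T`, a function
`F : S × T → [−1,1]` and a positive integer `α`, with `Λ = max_s (∑_t F(s,t))/|T|` and
`Λ' = max_s (F(s,t₁)+⋯+F(s,t_α))/α` for independent uniform samples `t₁,…,t_α ← T`,
one has `|E[Λ'] − Λ| ≤ (2 + √(log α + 2 log |S|))/√α`. -/
theorem stmt_15 {S T : Type*} [Fintype S] [Fintype T] [Nonempty S] [Nonempty T]
    (F : S → T → ℝ) (hF : ∀ s t, F s t ∈ Set.Icc (-1 : ℝ) 1) (α : ℕ) (hα : 0 < α) :
    |(∑ t : Fin α → T,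
        Finset.univ.sup' Finset.univ_nonempty (fun s : S => (∑ i, F s (t i)) / (α : ℝ))) /
          ((Fintype.card T : ℝ) ^ α) -
      Finset.univ.sup' Finset.univ_nonempty
        (fun s : S => (∑ t, F s t) / (Fintype.card T : ℝ))| ≤
      (2 + Real.sqrt (Real.log α + 2 * Real.log (Fintype.card S))) / Real.sqrt α := by
  have hα' : (0 : ℝ) < α := by exact_mod_cast hα
  have hlogα : 0 ≤ Real.log α := Real.log_natCast_nonneg α
  have hlogS : 0 ≤ Real.log (Fintype.card S) := Real.log_natCast_nonneg _
  set L := Real.log (Fintype.card S)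
  set r := Real.sqrt (Real.log α + 2 * L)
  set q := Real.sqrt α
  have hq : 0 < q := Real.sqrt_pos.2 hα'
  have hr : 0 ≤ r := Real.sqrt_nonneg _
  have hL : 2 * L ≤ r ^ 2 := by
    rw [Real.sq_sqrt (by positivity)]
    linarith
  have hqq : (α : ℝ) = q ^ 2 := (Real.sq_sqrt hα'.le).symm
  have hB : 0 < (2 + r) / q := by positivity
  have hup := sum_sup'_div_le F hF α hα hB
  have hlo := sup'_le_sum_sup'_div F α hα
  have hbound : L / ((2 + r) / q * α) + (2 + r) / q / 2 ≤ (2 + r) / q := by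
    have : L / ((2 + r) / q * α) ≤ (2 + r) / q / 2 := by
      rw [div_le_iff₀ (by positivity), hqq]
      have : (2 + r) / q / 2 * ((2 + r) / q * q ^ 2) = (2 + r) ^ 2 / 2 := by field_simp
      rw [this]
      nlinarith
    linarith
  rw [abs_of_nonneg (sub_nonneg.2 hlo)]
  linarith
end

section
/- Let (F₁,F₂,F₃,F₄) be a deterministic strategy for the 4-player GHZ game, and for j = 1,…,4 let v_j = ((−1)^{F_j(0)} + i·(−1)^{F_j(1)})/√2 ∈ ℂ. Then the winning probability of this strategy equals 1/2 + Re(v₁v₂v₃v₄)/4. -/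
lemma Complex.re_I_pow (n k : ℕ) (hk : (k : ZMod 2) = n) :
    (Complex.I ^ k).re =
      if (n : ZMod 2) = 0 then (if (k : ZMod 4) = 0 then 1 else -1) else 0 := by
  simp only [← hk, ZMod.natCast_eq_zero_iff]
  rw [Complex.I_pow_eq_pow_mod]
  have h : k % 4 < 4 := Nat.mod_lt _ (by norm_num)
  have h2 : 2 ∣ k ↔ 2 ∣ k % 4 := by omega
  have h4 : 4 ∣ k ↔ 4 ∣ k % 4 := by omega
  simp only [h2, h4]
  clear h2 h4
  generalize k % 4 = r at h
  interval_cases r <;> simp [pow_succ]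

/-- The real part of the phase attached to a question `x` and an answer `a` is `1` on a win,
`-1` on a loss, and `0` if the question has odd parity. -/
lemma re_prod_phase {ι : Type*} [Fintype ι] (x a : ι → Bool) :
    (∏ i, (if x i then Complex.I else 1) * (if a i then -1 else 1)).re =
      if (∑ i, (if x i then (1 : ZMod 2) else 0)) = 0 then
        (if (∑ i, (if x i then (1 : ZMod 4) else 0)) +
          2 * (∑ i, (if a i then (1 : ZMod 4) else 0)) = 0 then 1 else -1) else 0 := by
  have hphase : ∏ i, (if x i then Complex.I else 1) * (if a i then -1 else 1) =
      Complex.I ^ ((∑ i, if x i then 1 else 0) + 2 * ∑ i, if a i then 1 else 0) := by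
    rw [pow_add, pow_mul, Complex.I_sq, ← Finset.prod_pow_eq_pow_sum,
      ← Finset.prod_pow_eq_pow_sum, ← Finset.prod_mul_distrib]
    refine Finset.prod_congr rfl fun i _ => ?_
    cases x i <;> cases a i <;> simp
  have h2 : (2 : ZMod 2) = 0 := rfl
  rw [hphase, Complex.re_I_pow (∑ i, if x i then 1 else 0) _ (by push_cast; simp [h2])]
  push_cast
  rfl


/-- For a deterministic strategy `(F₁,F₂,F₃,F₄)` for the 4-player GHZ game,
setting `v_j = ((−1)^{F_j(0)} + i·(−1)^{F_j(1)})/√2`, the winning probability equals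
`1/2 + Re(v₁v₂v₃v₄)/4`. -/
theorem stmt_16 (F : Fin 4 → Bool → Bool)
    (v : Fin 4 → ℂ)
    (hv : ∀ j, v j = ((if F j false then -1 else 1) +
      Complex.I * (if F j true then -1 else 1)) / (Real.sqrt 2 : ℂ)) :
    (((Finset.univ.filter (fun x : Fin 4 → Bool =>
        (∑ i, (if x i then (1 : ZMod 2) else 0)) = 0 ∧
        (∑ i, (if x i then (1 : ZMod 4) else 0)) +
          2 * (∑ i, (if F i (x i) then (1 : ZMod 4) else 0)) = 0)).card : ℝ) /
      ((Finset.univ.filter (fun x : Fin 4 → Bool =>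
        (∑ i, (if x i then (1 : ZMod 2) else 0)) = 0)).card : ℝ)) =
      1 / 2 + (v 0 * v 1 * v 2 * v 3).re / 4 := by
  have hre : (v 0 * v 1 * v 2 * v 3).re = (∑ x : Fin 4 → Bool,
      (∏ i, (if x i then Complex.I else 1) * (if F i (x i) then -1 else 1)).re) / 4 := by
    have hsqrt : (Real.sqrt 2 : ℂ) ^ 4 = 4 := by
      have h : (Real.sqrt 2) ^ 4 = 4 := by
        rw [show 4 = 2 * 2 from rfl, pow_mul, Real.sq_sqrt (by norm_num)]
        norm_num
      exact_mod_cast h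
    have hprod : v 0 * v 1 * v 2 * v 3 = (∑ x : Fin 4 → Bool,
        ∏ i, (if x i then Complex.I else 1) * (if F i (x i) then -1 else 1)) / 4 := by
      rw [← Fin.prod_univ_four, ← Fintype.piFinset_univ, ← Finset.prod_univ_sum
        (fun _ => Finset.univ)
        (fun i b => (if b then Complex.I else 1) * (if F i b then -1 else 1))]
      simp_rw [hv]
      rw [Finset.prod_div_distrib, Finset.prod_const, Finset.card_univ, Fintype.card_fin, hsqrt]
      simp [add_comm]
    rw [hprod, ← Complex.re_sum]
    exact Complex.div_ofNat_re _ 4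
  have hcard : (Finset.univ.filter (fun x : Fin 4 → Bool =>
      (∑ i, (if x i then (1 : ZMod 2) else 0)) = 0)).card = 8 := by decide
  simp_rw [hre, re_prod_phase]
  rw [← Finset.sum_filter, ← Finset.filter_filter]
  set E := Finset.univ.filter (fun x : Fin 4 → Bool =>
    (∑ i, (if x i then (1 : ZMod 2) else 0)) = 0)
  rw [Finset.sum_ite, Finset.sum_const, Finset.sum_const, hcard]
  have hsplit := Finset.card_filter_add_card_filter_not (s := E) (fun x : Fin 4 → Bool =>
    (∑ i, (if x i then (1 : ZMod 4) else 0)) +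
      2 * (∑ i, (if F i (x i) then (1 : ZMod 4) else 0)) = 0)
  rw [hcard] at hsplit
  have hsplit' := congrArg (Nat.cast : ℕ → ℝ) hsplit
  push_cast at hsplit'
  simp only [nsmul_eq_mul]
  push_cast
  linarith
end
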